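/- The set L({n² : n ≥ 2}) = { x ∈ ℓ∞ : |L_x| is a perfect square ≥ 4 } is not lineable: L({n²:n≥2}) ∪ {0} contains no infinite-dimensional linear subspace. -/

import Mathlib

open Filter Topology Set ENNReal

noncomputable section

/-- The set of accumulation points of a real sequence: limits of convergent subsequences. -/
def accPts (x : ℕ → ℝ) : Set ℝ :=
  {a | ∃ φ : ℕ → ℕ, StrictMono φ ∧ Tendsto (fun k => x (φ k)) atTop (𝓝 a)}


/-- The space ℓ∞ of bounded real sequences. -/
abbrev Linf : Type := ↥(lp (fun _ : ℕ => ℝ) ∞)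

/-- Accumulation points of an element of ℓ∞. -/
def accPtsL (z : Linf) : Set ℝ := accPts (fun n => z n)

/-- The slopes `t` for which the projection `p ↦ p.2 + t * p.1` identifies two points of `F`
with distinct abscissae. -/
def collisionSlopes (F : Finset (ℝ × ℝ)) : Finset ℝ :=
  ((F ×ˢ F).filter fun w => w.1.1 < w.2.1).image fun w => (w.1.2 - w.2.2) / (w.2.1 - w.1.1)

theorem mem_collisionSlopes {F : Finset (ℝ × ℝ)} {p q : ℝ × ℝ} (hp : p ∈ F) (hq : q ∈ F)
    (h : p.1 < q.1) : (p.2 - q.2) / (q.1 - p.1) ∈ collisionSlopes F :=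
  Finset.mem_image.2 ⟨(p, q), by simp [hp, hq, h], rfl⟩

/-- Some projection `p ↦ p.2 + t * p.1` is injective on a given finite planar set. -/
theorem exists_injOn_projection (F : Finset (ℝ × ℝ)) :
    ∃ t : ℝ, Set.InjOn (fun p : ℝ × ℝ => p.2 + t * p.1) F := by
  obtain ⟨t, ht⟩ := Infinite.exists_notMem_finset (collisionSlopes F)
  have key : ∀ p ∈ F, ∀ q ∈ F, p.2 + t * p.1 = q.2 + t * q.1 → ¬ p.1 < q.1 := by
    intro p hp q hq h hlt
    apply ht
    convert mem_collisionSlopes hp hq hlt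
    rw [eq_div_iff (sub_pos.2 hlt).ne']
    linarith
  refine ⟨t, fun p hp q hq h => ?_⟩
  have h1 : p.1 = q.1 := le_antisymm (not_lt.1 (key q hq p hp h.symm)) (not_lt.1 (key p hp q hq h))
  refine Prod.ext h1 ?_
  simp only [h1] at h
  linarith

/-- Some projection `p ↦ p.2 + t * p.1` is not injective on a finite planar set `F`, but loses at
most as many points as `F` has abscissae. -/
theorem exists_projection_card_lt (F : Finset (ℝ × ℝ)) {a b : ℝ × ℝ} (ha : a ∈ F) (hb : b ∈ F)
    (hab : a.1 < b.1) :
    ∃ t : ℝ, (F.image fun p : ℝ × ℝ => p.2 + t * p.1).card < F.card ∧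
      F.card ≤ (F.image fun p : ℝ × ℝ => p.2 + t * p.1).card + (F.image Prod.fst).card := by
  have hne : (collisionSlopes F).Nonempty := ⟨_, mem_collisionSlopes ha hb hab⟩
  set t := (collisionSlopes F).max' hne with ht
  have hmono : ∀ p ∈ F, ∀ q ∈ F, p.1 < q.1 → p.2 + t * p.1 ≤ q.2 + t * q.1 := by
    intro p hp q hq h
    have := (collisionSlopes F).le_max' _ (mem_collisionSlopes hp hq h)
    rw [← ht, div_le_iff₀ (sub_pos.2 h)] at this
    linarith
  refine ⟨t, ?_, ?_⟩
  · refine lt_of_le_of_ne Finset.card_image_le fun h => ?_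
    have hinj := Finset.card_image_iff.1 h
    obtain ⟨⟨p, q⟩, hpq, he⟩ := Finset.mem_image.1 ((collisionSlopes F).max'_mem hne)
    simp only [Finset.mem_filter, Finset.mem_product] at hpq
    rw [← ht, div_eq_iff (sub_pos.2 hpq.2).ne'] at he
    have hpq' : p = q := hinj hpq.1.1 hpq.1.2 (by dsimp only at he ⊢; linarith)
    exact hpq.2.ne (by rw [hpq'])
  · classical
    rw [← Finset.card_filter_add_card_filter_not (s := F)
      (fun p => ∃ r ∈ F, r.1 = p.1 ∧ r.2 < p.2)]
    have hnot : ∀ p ∈ F, ∀ q ∈ F, (∃ r ∈ F, r.1 = q.1 ∧ r.2 < q.2) →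
        p.2 + t * p.1 = q.2 + t * q.1 → ¬ p.1 < q.1 := by
      rintro p hp q hq ⟨r, hr, hr1, hr2⟩ h hlt
      have := hmono p hp r hr (hr1 ▸ hlt)
      rw [hr1] at this
      linarith
    refine add_le_add ?_ ?_
    · refine Finset.card_le_card_of_injOn (fun p : ℝ × ℝ => p.2 + t * p.1) ?_ ?_
      · intro p hp
        exact Finset.mem_image_of_mem _ (Finset.mem_filter.1 hp).1
      · intro p hp q hq h
        obtain ⟨hp, hp'⟩ := Finset.mem_filter.1 hp
        obtain ⟨hq, hq'⟩ := Finset.mem_filter.1 hq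
        have h1 : p.1 = q.1 :=
          le_antisymm (not_lt.1 (hnot q hq p hp hp' h.symm)) (not_lt.1 (hnot p hp q hq hq' h))
        refine Prod.ext h1 ?_
        simp only [h1] at h
        linarith
    · refine Finset.card_le_card_of_injOn Prod.fst ?_ ?_
      · intro p hp
        exact Finset.mem_image_of_mem _ (Finset.mem_filter.1 hp).1
      · intro p hp q hq h
        obtain ⟨hp, hp'⟩ := Finset.mem_filter.1 hp
        obtain ⟨hq, hq'⟩ := Finset.mem_filter.1 hq
        push Not at hp' hq'
        exact Prod.ext h (le_antisymm (hp' q hq h.symm) (hq' p hp h))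

section FunctionSpace

variable {X M : Type*} [AddCommGroup M] [Module ℝ M] (E : M →ₗ[ℝ] (X → ℝ))

theorem finite_range_pair (hfin : ∀ z, (Set.range (E z)).Finite) (f g : M) :
    (Set.range fun u => (E f u, E g u)).Finite :=
  ((hfin f).prod (hfin g)).subset (by rintro _ ⟨u, rfl⟩; exact ⟨⟨u, rfl⟩, ⟨u, rfl⟩⟩)

/-- The finite set of joint values of two functions in a space of finitely-valued functions. -/
def jointValues (hfin : ∀ z, (Set.range (E z)).Finite) (f g : M) : Finset (ℝ × ℝ) :=
  (finite_range_pair E hfin f g).toFinset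

variable {E}

theorem coe_jointValues (hfin : ∀ z, (Set.range (E z)).Finite)
    (f g : M) :
    (jointValues E hfin f g : Set (ℝ × ℝ)) = Set.range fun u => (E f u, E g u) := by
  simp [jointValues]

theorem mem_jointValues (hfin : ∀ z, (Set.range (E z)).Finite)
    (f g : M) (u : X) : (E f u, E g u) ∈ jointValues E hfin f g := by
  exact (finite_range_pair E hfin f g).mem_toFinset.2 ⟨u, rfl⟩

theorem card_image_projection_jointValues (hfin : ∀ z, (Set.range (E z)).Finite)
    (f g : M) (t : ℝ) :
    ((jointValues E hfin f g).image fun p : ℝ × ℝ => p.2 + t * p.1).card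
      = (Set.range (E (g + t • f))).ncard := by
  rw [← Set.ncard_coe_finset, Finset.coe_image, coe_jointValues, ← Set.range_comp]
  congr 2
  ext u
  simp

theorem card_image_fst_jointValues (hfin : ∀ z, (Set.range (E z)).Finite)
    (f g : M) :
    ((jointValues E hfin f g).image Prod.fst).card = (Set.range (E f)).ncard := by
  rw [← Set.ncard_coe_finset, Finset.coe_image, coe_jointValues, ← Set.range_comp]
  rfl

theorem card_image_snd_jointValues (hfin : ∀ z, (Set.range (E z)).Finite)
    (f g : M) :
    ((jointValues E hfin f g).image Prod.snd).card = (Set.range (E g)).ncard := by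
  rw [← Set.ncard_coe_finset, Finset.coe_image, coe_jointValues, ← Set.range_comp]
  rfl

theorem exists_card_jointValues_eq (hfin : ∀ z, (Set.range (E z)).Finite)
    (f g : M) :
    ∃ t : ℝ, (jointValues E hfin f g).card = (Set.range (E (g + t • f))).ncard := by
  obtain ⟨t, ht⟩ := exists_injOn_projection (jointValues E hfin f g)
  exact ⟨t, by rw [← card_image_projection_jointValues hfin, Finset.card_image_of_injOn ht]⟩

theorem ncard_range_le_of_isSquare (hfin : ∀ z, (Set.range (E z)).Finite)
    (hsq : ∀ z, IsSquare (Set.range (E z)).ncard) {f : M}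
    (hf : 1 < (Set.range (E f)).ncard) (g : M) :
    (Set.range (E g)).ncard ≤ (Set.range (E f)).ncard ^ 2 := by
  obtain ⟨u, v, huv⟩ : ∃ u v, E f u < E f v := by
    obtain ⟨_, _, ⟨u, rfl⟩, ⟨v, rfl⟩, h⟩ := (Set.one_lt_ncard_iff (hfin f)).1 hf
    rcases lt_or_gt_of_ne h with h | h
    exacts [⟨u, v, h⟩, ⟨v, u, h⟩]
  obtain ⟨t, h1, h2⟩ := exists_projection_card_lt (jointValues E hfin f g)
    (mem_jointValues hfin f g u) (mem_jointValues hfin f g v) huv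
  obtain ⟨s, hs⟩ := exists_card_jointValues_eq hfin f g
  have h3 : (Set.range (E g)).ncard ≤ (jointValues E hfin f g).card := by
    rw [← card_image_snd_jointValues hfin f g]
    exact Finset.card_image_le
  rw [card_image_projection_jointValues] at h1 h2
  rw [card_image_fst_jointValues] at h2
  obtain ⟨n, hn⟩ := hsq (g + s • f)
  obtain ⟨m, hm⟩ := hsq (g + t • f)
  rw [hs, hn] at h1 h2 h3
  rw [hm] at h1 h2
  have hmn : m < n := by by_contra! h; nlinarith
  have hnk : n ≤ (Set.range (E f)).ncard := by nlinarith
  nlinarith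

/-- A space of finitely-valued functions, nonconstant except for zero, whose numbers of values are
all perfect squares, is finite-dimensional. -/
theorem module_finite_of_isSquare_ncard_range (hfin : ∀ z, (Set.range (E z)).Finite)
    (hsq : ∀ z, IsSquare (Set.range (E z)).ncard)
    (hlt : ∀ z, z ≠ 0 → 1 < (Set.range (E z)).ncard) : Module.Finite ℝ M := by
  by_cases hM : ∃ f : M, f ≠ 0
  swap
  · push Not at hM
    have : Subsingleton M := ⟨fun a b => by rw [hM a, hM b]⟩
    infer_instance
  obtain ⟨f, hf⟩ := hM
  have hbdd : BddAbove (Set.range fun g => (Set.range (E g)).ncard) :=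
    ⟨_, by rintro _ ⟨g, rfl⟩; exact ncard_range_le_of_isSquare hfin hsq (hlt f hf) g⟩
  obtain ⟨g, hg⟩ := Nat.sSup_mem (Set.range_nonempty _) hbdd
  have hmax : ∀ h, (Set.range (E h)).ncard ≤ (Set.range (E g)).ncard := fun h =>
    (le_csSup hbdd ⟨h, rfl⟩).trans hg.ge
  have hfactor : ∀ h u v, E g u = E g v → E h u = E h v := by
    intro h u v huv
    obtain ⟨t, ht⟩ := exists_card_jointValues_eq hfin h g
    have hinj : Set.InjOn Prod.snd (jointValues E hfin h g : Set (ℝ × ℝ)) := by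
      apply Finset.card_image_iff.1
      refine le_antisymm Finset.card_image_le ?_
      rw [card_image_snd_jointValues, ht]
      exact hmax _
    exact congrArg Prod.fst (hinj (mem_jointValues hfin h g u) (mem_jointValues hfin h g v) huv)
  have : Finite (Set.range (E g)) := hfin g
  choose c hc using fun r : Set.range (E g) => r.2
  refine Module.Finite.of_injective ((LinearMap.funLeft ℝ ℝ c).comp E) ?_
  rw [← LinearMap.ker_eq_bot, LinearMap.ker_eq_bot']
  intro z hz
  by_contra hne
  obtain ⟨_, _, ⟨u, rfl⟩, ⟨v, rfl⟩, h⟩ := (Set.one_lt_ncard_iff (hfin z)).1 (hlt z hne)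
  have hzero : ∀ w, E z w = 0 := fun w => by
    rw [hfactor z w (c ⟨E g w, w, rfl⟩) (hc ⟨E g w, w, rfl⟩).symm]
    exact congrFun hz _
  exact h (by rw [hzero u, hzero v])

end FunctionSpace

theorem exists_tendsto_ultrafilter (z : Linf) (U : Ultrafilter ℕ) :
    ∃ a : ℝ, Tendsto (fun n => z n) U (𝓝 a) := by
  obtain ⟨a, -, ha⟩ := (isCompact_closedBall (0 : ℝ) ‖z‖).ultrafilter_le_nhds
    (U.map fun n => z n) (by
      refine Filter.le_principal_iff.2 (Filter.mem_map.2 (Filter.univ_mem' fun n => ?_))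
      simpa using lp.norm_apply_le_norm ENNReal.top_ne_zero z n)
  exact ⟨a, ha⟩

/-- The limits of bounded sequences along the nonprincipal ultrafilters. -/
def ultrafilterLimit : Linf →ₗ[ℝ] ({U : Ultrafilter ℕ // (U : Filter ℕ) ≤ atTop} → ℝ) where
  toFun z U := (exists_tendsto_ultrafilter z U).choose
  map_add' y z := by
    ext U
    exact tendsto_nhds_unique (exists_tendsto_ultrafilter (y + z) U).choose_spec
      ((exists_tendsto_ultrafilter y U).choose_spec.add
        (exists_tendsto_ultrafilter z U).choose_spec)
  map_smul' c z := by
    ext U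
    exact tendsto_nhds_unique (exists_tendsto_ultrafilter (c • z) U).choose_spec
      ((exists_tendsto_ultrafilter z U).choose_spec.const_mul c)

theorem tendsto_ultrafilterLimit (z : Linf) (U : {U : Ultrafilter ℕ // (U : Filter ℕ) ≤ atTop}) :
    Tendsto (fun n => z n) (U : Ultrafilter ℕ) (𝓝 (ultrafilterLimit z U)) :=
  (exists_tendsto_ultrafilter z U).choose_spec

theorem range_ultrafilterLimit (z : Linf) : Set.range (ultrafilterLimit z) = accPtsL z := by
  ext a
  constructor
  · rintro ⟨U, rfl⟩
    exact MapClusterPt.tendsto_subseq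
      (mapClusterPt_iff_ultrafilter.2 ⟨U, U.2, tendsto_ultrafilterLimit z U⟩)
  · rintro ⟨φ, hφ, h⟩
    obtain ⟨U, hU, hlim⟩ := mapClusterPt_iff_ultrafilter.1
      (h.mapClusterPt.of_comp hφ.tendsto_atTop)
    exact ⟨⟨U, hU⟩, tendsto_nhds_unique (tendsto_ultrafilterLimit z ⟨U, hU⟩) hlim⟩

theorem accPtsL_zero_subset : accPtsL 0 ⊆ {0} := by
  rintro a ⟨φ, -, h⟩
  exact tendsto_nhds_unique h tendsto_const_nhds

theorem squares_not_lineable (M : Submodule ℝ Linf)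
    (hM : ∀ z ∈ M, z ≠ 0 → (accPtsL z).Finite ∧
      ∃ n : ℕ, 2 ≤ n ∧ (accPtsL z).ncard = n ^ 2) :
    Module.Finite ℝ M := by
  have hrange : ∀ z : M, Set.range ((ultrafilterLimit.comp M.subtype) z) = accPtsL z :=
    fun z => range_ultrafilterLimit z
  refine module_finite_of_isSquare_ncard_range (E := ultrafilterLimit.comp M.subtype) ?_ ?_ ?_
  · intro z
    rw [hrange]
    by_cases hz : (z : Linf) = 0
    · rw [hz]
      exact (Set.finite_singleton 0).subset accPtsL_zero_subset
    · exact (hM z z.2 hz).1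
  · intro z
    rw [hrange]
    by_cases hz : (z : Linf) = 0
    · rw [hz]
      rcases Set.subset_singleton_iff_eq.1 accPtsL_zero_subset with h | h <;> simp [h]
    · obtain ⟨-, n, -, hn⟩ := hM z z.2 hz
      exact ⟨n, by rw [hn, sq]⟩
  · intro z hz
    rw [hrange]
    obtain ⟨-, n, h2, hn⟩ := hM z z.2 (by simpa using hz)
    rw [hn]
    nlinarith
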